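/- In a Sturmian word, no factor of length greater than 1 admits two distinct abelian-equivalent semi-abelian returns; equivalently, any two semi-abelian returns of the same length l > 1 to a given factor are equal. -/

import Mathlib

/-- The factor of length `n` of the infinite word `w` starting at position `i`. -/
def wordAt {α : Type*} (w : ℕ → α) (i n : ℕ) : List α :=
  (List.range n).map (fun k => w (i + k))

/-- `u` is a factor of the infinite word `w`. -/
def IsFactorW {α : Type*} (w : ℕ → α) (u : List α) : Prop :=
  ∃ i, u = wordAt w i u.length

/-- `w` is recurrent: every factor occurs infinitely often. -/
def RecurrentW {α : Type*} (w : ℕ → α) : Prop :=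
  ∀ u, IsFactorW w u → ∀ N, ∃ i, N ≤ i ∧ u = wordAt w i u.length

/-- `w` is (purely) periodic. -/
def PeriodicW {α : Type*} (w : ℕ → α) : Prop :=
  ∃ T, 0 < T ∧ ∀ n, w (n + T) = w n

/-- `w` is ultimately periodic. -/
def UltPeriodicW {α : Type*} (w : ℕ → α) : Prop :=
  ∃ T, 0 < T ∧ ∃ n₀, ∀ n, n₀ ≤ n → w (n + T) = w n

/-- Two finite words are abelian equivalent: same number of occurrences of each letter. -/
def AbEquiv {α : Type*} [DecidableEq α] (u v : List α) : Prop :=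
  ∀ a : α, u.count a = v.count a

/-- Positions of occurrences of words abelian equivalent to `u` in `w`. -/
def abOcc {α : Type*} [DecidableEq α] (w : ℕ → α) (u : List α) : Set ℕ :=
  {i | AbEquiv (wordAt w i u.length) u}

/-- The semi-abelian returns to (the abelian class of) `u` in `w`: words extending from one
occurrence of the abelian class of `u` to the next one. -/
def semiAbReturns {α : Type*} [DecidableEq α] (w : ℕ → α) (u : List α) : Set (List α) :=
  {r | ∃ i j, i ∈ abOcc w u ∧ j ∈ abOcc w u ∧ i < j ∧
      (∀ k, i < k → k < j → k ∉ abOcc w u) ∧ r = wordAt w i (j - i)}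

/-- Positions of (exact) occurrences of `u` in `w`. -/
def occW {α : Type*} [DecidableEq α] (w : ℕ → α) (u : List α) : Set ℕ :=
  {i | u = wordAt w i u.length}

/-- The ordinary return words of `u` in `w`. -/
def returnWords {α : Type*} [DecidableEq α] (w : ℕ → α) (u : List α) : Set (List α) :=
  {r | ∃ i j, i ∈ occW w u ∧ j ∈ occW w u ∧ i < j ∧
      (∀ k, i < k → k < j → k ∉ occW w u) ∧ r = wordAt w i (j - i)}

/-- `u` has exactly `k` semi-abelian returns in `w`. -/
def ExactlyKSemiAbReturns {α : Type*} [DecidableEq α] (w : ℕ → α) (u : List α) (k : ℕ) : Prop :=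
  ∃ f : Fin k → List α, Function.Injective f ∧ semiAbReturns w u = Set.range f

/-- `u` has exactly `k` abelian returns in `w`: there are `k` pairwise non-abelian-equivalent
representatives so that every semi-abelian return is abelian equivalent to exactly one of them,
and each representative is realized. -/
def ExactlyKAbReturns {α : Type*} [DecidableEq α] (w : ℕ → α) (u : List α) (k : ℕ) : Prop :=
  ∃ f : Fin k → List α,
    (∀ i j, AbEquiv (f i) (f j) → i = j) ∧
    (∀ r ∈ semiAbReturns w u, ∃ i, AbEquiv r (f i)) ∧
    (∀ i, ∃ r ∈ semiAbReturns w u, AbEquiv r (f i))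

/-- `u` has at most `k` abelian returns in `w`. -/
def AtMostKAbReturns {α : Type*} [DecidableEq α] (w : ℕ → α) (u : List α) (k : ℕ) : Prop :=
  ∃ f : Fin k → List α, ∀ r ∈ semiAbReturns w u, ∃ i, AbEquiv r (f i)

/-- `u` has at least `k` abelian returns in `w`. -/
def AtLeastKAbReturns {α : Type*} [DecidableEq α] (w : ℕ → α) (u : List α) (k : ℕ) : Prop :=
  ∃ f : Fin k → List α,
    (∀ i j, AbEquiv (f i) (f j) → i = j) ∧
    (∀ i, ∃ r ∈ semiAbReturns w u, AbEquiv r (f i))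

/-- `u` has at least two semi-abelian returns in `w`. -/
def AtLeastTwoSemiAbReturns {α : Type*} [DecidableEq α] (w : ℕ → α) (u : List α) : Prop :=
  ∃ r₁ r₂, r₁ ∈ semiAbReturns w u ∧ r₂ ∈ semiAbReturns w u ∧ r₁ ≠ r₂

/-- The factor complexity of `w`. -/
noncomputable def complexityW {α : Type*} (w : ℕ → α) (n : ℕ) : ℕ :=
  {u : List α | u.length = n ∧ IsFactorW w u}.ncard

/-- A Sturmian word: aperiodic binary word with factor complexity `n + 1`. -/
def SturmianW (w : ℕ → Bool) : Prop :=
  ¬ UltPeriodicW w ∧ ∀ n, complexityW w n = n + 1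

/-- Right special factor of a binary word. -/
def RightSpecial (w : ℕ → Bool) (B : List Bool) : Prop :=
  IsFactorW w (B ++ [false]) ∧ IsFactorW w (B ++ [true])

/-- Left special factor of a binary word. -/
def LeftSpecial (w : ℕ → Bool) (B : List Bool) : Prop :=
  IsFactorW w (false :: B) ∧ IsFactorW w (true :: B)

/-- Bispecial factor of a binary word. -/
def Bispecial (w : ℕ → Bool) (B : List Bool) : Prop :=
  RightSpecial w B ∧ LeftSpecial w B

/-- `w` is `c`-balanced. -/
def CBalanced {α : Type*} [DecidableEq α] (w : ℕ → α) (c : ℕ) : Prop :=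
  ∀ u v : List α, IsFactorW w u → IsFactorW w v → u.length = v.length →
    ∀ a : α, |((u.count a : ℤ) - (v.count a : ℤ))| ≤ (c : ℤ)

theorem wordAt_length {α : Type*} (w : ℕ → α) (i n : ℕ) : (wordAt w i n).length = n := by
  simp [wordAt]

theorem wordAt_succ {α : Type*} (w : ℕ → α) (i n : ℕ) :
    wordAt w i (n + 1) = wordAt w i n ++ [w (i + n)] := by
  simp [wordAt, List.range_succ]

theorem wordAt_eq_iff {α : Type*} (w : ℕ → α) (i j n : ℕ) :
    wordAt w i n = wordAt w j n ↔ ∀ m < n, w (i + m) = w (j + m) := by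
  simp [wordAt]

/-- The set of factors of length `n` of `w`. -/
def factorsOfLength {α : Type*} (w : ℕ → α) (n : ℕ) : Set (List α) :=
  Set.range fun i => wordAt w i n

theorem complexityW_eq_ncard {α : Type*} (w : ℕ → α) (n : ℕ) :
    complexityW w n = (factorsOfLength w n).ncard := by
  unfold complexityW
  congr 1
  ext u
  constructor
  · rintro ⟨rfl, i, hi⟩
    exact ⟨i, hi.symm⟩
  · rintro ⟨i, rfl⟩
    exact ⟨wordAt_length w i n, i, by simp only [wordAt_length]⟩

theorem SturmianW.ncard_factorsOfLength {w : ℕ → Bool} (hst : SturmianW w) (n : ℕ) :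
    (factorsOfLength w n).ncard = n + 1 := by
  rw [← complexityW_eq_ncard, hst.2]

theorem SturmianW.finite_factorsOfLength {w : ℕ → Bool} (hst : SturmianW w) (n : ℕ) :
    (factorsOfLength w n).Finite :=
  Set.finite_of_ncard_ne_zero (by rw [hst.ncard_factorsOfLength]; omega)

/-- The factor of length `n` starting at `i` is followed by two different letters in `w`. -/
def BranchesAt {α : Type*} (w : ℕ → α) (n i : ℕ) : Prop :=
  ∃ j, wordAt w j n = wordAt w i n ∧ w (j + n) ≠ w (i + n)

theorem BranchesAt.exists_ne {α : Type*} {w : ℕ → α} {n i : ℕ} (h : BranchesAt w n i) (a : α) :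
    ∃ j, wordAt w j n = wordAt w i n ∧ w (j + n) ≠ a := by
  obtain ⟨j, hj, hne⟩ := h
  by_cases ha : w (j + n) = a
  · exact ⟨i, rfl, fun hi => hne (ha.trans hi.symm)⟩
  · exact ⟨j, hj, ha⟩

theorem branchesAt_of_ne {α : Type*} {w : ℕ → α} {n i j k : ℕ}
    (hj : wordAt w j n = wordAt w i n) (hk : wordAt w k n = wordAt w i n)
    (hne : w (j + n) ≠ w (k + n)) : BranchesAt w n i := by
  by_cases ha : w (j + n) = w (i + n)
  · exact ⟨k, hk, fun h => hne (ha.trans h.symm)⟩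
  · exact ⟨j, hj, ha⟩

/-- A Sturmian word has at most one right special factor of each length. -/
theorem SturmianW.wordAt_eq_of_branchesAt {w : ℕ → Bool} (hst : SturmianW w) {n p q : ℕ}
    (hp : BranchesAt w n p) (hq : BranchesAt w n q) : wordAt w p n = wordAt w q n := by
  by_contra hne
  have hpos : ∀ u ∈ factorsOfLength w n, ∃ i, wordAt w i n = u := fun u hu => hu
  choose! f hf using hpos
  have hfw : ∀ i, wordAt w (f (wordAt w i n)) n = wordAt w i n := fun i => hf _ ⟨i, rfl⟩
  set g : List Bool → List Bool := fun u => wordAt w (f u) (n + 1) with hg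
  have take_succ : ∀ i, (wordAt w i (n + 1)).take n = wordAt w i n := fun i => by
    rw [wordAt_succ, List.take_left' (wordAt_length w i n)]
  have hinj : Set.InjOn g (factorsOfLength w n) := by
    intro u hu v hv huv
    have := congrArg (List.take n) huv
    simpa only [hg, take_succ, hf u hu, hf v hv] using this
  have key : ∀ i, BranchesAt w n i → ∃ j, wordAt w j n = wordAt w i n ∧
      wordAt w j (n + 1) ∉ g '' factorsOfLength w n := by
    intro i hi
    obtain ⟨j, hj, hne⟩ := hi.exists_ne (w (f (wordAt w i n) + n))
    refine ⟨j, hj, ?_⟩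
    rintro ⟨u, hu, huj⟩
    have h1 := congrArg (List.take n) huj
    simp only [hg, take_succ, hf u hu] at h1
    rw [h1, hj] at huj
    simp only [hg] at huj
    rw [wordAt_eq_iff] at huj
    exact hne (huj n (Nat.lt_succ_self n)).symm
  obtain ⟨p', hp', hpn⟩ := key p hp
  obtain ⟨q', hq', hqn⟩ := key q hq
  have hpq : wordAt w p' (n + 1) ≠ wordAt w q' (n + 1) := by
    intro h
    have := congrArg (List.take n) h
    rw [take_succ, take_succ, hp', hq'] at this
    exact hne this
  have hfin : (g '' factorsOfLength w n).Finite := (hst.finite_factorsOfLength n).image g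
  have hcard : (insert (wordAt w p' (n + 1)) (insert (wordAt w q' (n + 1))
      (g '' factorsOfLength w n))).ncard = n + 3 := by
    rw [Set.ncard_insert_of_notMem _ (hfin.insert _), Set.ncard_insert_of_notMem hqn hfin,
      hinj.ncard_image, hst.ncard_factorsOfLength]
    simp only [Set.mem_insert_iff, not_or]
    exact ⟨hpq, hpn⟩
  have hle := Set.ncard_le_ncard (s := insert (wordAt w p' (n + 1)) (insert (wordAt w q' (n + 1))
      (g '' factorsOfLength w n))) (t := factorsOfLength w (n + 1)) (by
    rintro u (rfl | rfl | ⟨v, -, rfl⟩)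
    exacts [⟨_, rfl⟩, ⟨_, rfl⟩, ⟨_, rfl⟩]) (hst.finite_factorsOfLength _)
  rw [hcard, hst.ncard_factorsOfLength] at hle
  omega

/-- If a factor recurs and no factor read in between branches, the word is ultimately periodic. -/
theorem ultPeriodicW_of_not_branchesAt {α : Type*} {w : ℕ → α} {n p q : ℕ} (hpq : p < q)
    (heq : wordAt w p n = wordAt w q n)
    (hdet : ∀ x, p ≤ x → x < q → ¬ BranchesAt w n x) : UltPeriodicW w := by
  have step : ∀ i j, wordAt w i n = wordAt w j n → w (i + n) = w (j + n) →
      wordAt w (i + 1) n = wordAt w (j + 1) n := by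
    intro i j h h'
    rw [wordAt_eq_iff] at h ⊢
    intro m hm
    rw [add_assoc, add_assoc, add_comm 1 m]
    rcases Nat.lt_or_ge (m + 1) n with h1 | h1
    · exact h _ h1
    · rwa [show m + 1 = n by omega]
  have main : ∀ t, wordAt w (p + t) n = wordAt w (q + t) n ∧
      ∃ x, p ≤ x ∧ x < q ∧ wordAt w (p + t) n = wordAt w x n := by
    intro t
    induction t with
    | zero => exact ⟨heq, p, le_rfl, hpq, rfl⟩
    | succ t ih =>
      obtain ⟨h, x, hx, hxq, hpx⟩ := ih
      have h1 : w (p + t + n) = w (x + n) := by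
        by_contra hne
        exact hdet x hx hxq ⟨_, hpx, hne⟩
      have h2 : w (q + t + n) = w (x + n) := by
        by_contra hne
        exact hdet x hx hxq ⟨_, h.symm.trans hpx, hne⟩
      refine ⟨step _ _ h (h1.trans h2.symm), ?_⟩
      have h3 := step _ _ hpx h1
      rcases Nat.lt_or_ge (x + 1) q with hlt | hge
      · exact ⟨x + 1, by omega, hlt, h3⟩
      · rw [show x + 1 = q by omega, ← heq] at h3
        exact ⟨p, le_rfl, hpq, h3⟩
  refine ⟨q - p, by omega, p + n, fun m hm => ?_⟩
  obtain ⟨h, x, hx, hxq, hpx⟩ := main (m - p - n)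
  have h1 : w (p + (m - p - n) + n) = w (x + n) := by
    by_contra hne
    exact hdet x hx hxq ⟨_, hpx, hne⟩
  have h2 : w (q + (m - p - n) + n) = w (x + n) := by
    by_contra hne
    exact hdet x hx hxq ⟨_, h.symm.trans hpx, hne⟩
  rw [show p + (m - p - n) + n = m by omega] at h1
  rw [show q + (m - p - n) + n = m + (q - p) by omega] at h2
  exact h2.trans h1.symm

/-- If `a v a` and `b v b` are factors of a Sturmian word with `v` a palindrome and `a ≠ b`, then
`a v` is right special. Here `a v a` and `b v b` have length `n + 1` and occur at `i` and `j`. -/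
theorem SturmianW.branchesAt_of_palindrome {w : ℕ → Bool} (hst : SturmianW w) {n i j : ℕ}
    (hn : 0 < n) (hij : w i ≠ w j) (hi : w (i + n) = w i) (hj : w (j + n) = w j)
    (hcom : ∀ m, 0 < m → m < n → w (i + m) = w (j + m))
    (hpal : ∀ m, 0 < m → m < n → w (i + m) = w (i + (n - m))) : BranchesAt w n i := by
  by_contra hnb
  have avoid : ∀ k ≤ n, wordAt w (i + k) n ≠ wordAt w j n := by
    intro k hk h
    rw [wordAt_eq_iff] at h
    have h0 : w (i + k) = w j := by simpa using h 0 hn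
    rcases Nat.eq_zero_or_pos k with rfl | hk0
    · exact hij h0
    rcases hk.eq_or_lt with rfl | hkn
    · exact hij (hi.symm.trans h0)
    · have h1 := h (n - k) (by omega)
      rw [show i + k + (n - k) = i + n by omega, ← hcom (n - k) (by omega) (by omega),
        ← hpal k hk0 hkn, h0, hi] at h1
      exact hij h1
  have suffix_branches : ∀ x, BranchesAt w n x → BranchesAt w (n - 1) (x + 1) := by
    rintro x ⟨y, hy, hne⟩
    rw [wordAt_eq_iff] at hy
    refine ⟨y + 1, ?_, ?_⟩
    · rw [wordAt_eq_iff]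
      intro m hm
      simpa only [add_assoc, add_comm 1 m] using hy (m + 1) (by omega)
    · rwa [show y + 1 + (n - 1) = y + n by omega, show x + 1 + (n - 1) = x + n by omega]
  have hv : BranchesAt w (n - 1) (i + 1) := by
    refine ⟨j + 1, ?_, ?_⟩
    · rw [wordAt_eq_iff]
      intro m hm
      simpa only [add_assoc, add_comm 1 m] using (hcom (m + 1) (by omega) (by omega)).symm
    · rw [show j + 1 + (n - 1) = j + n by omega, show i + 1 + (n - 1) = i + n by omega, hi, hj]
      exact hij.symm
  have hdet : ∀ k ≤ n, ¬ BranchesAt w n (i + k) := by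
    intro k hk hb
    have h := hst.wordAt_eq_of_branchesAt (suffix_branches _ hb) hv
    rw [wordAt_eq_iff] at h
    have hshift : ∀ m, 0 < m → m < n → w (i + k + m) = w (i + m) := by
      intro m hm hmn
      have := h (m - 1) (by omega)
      rwa [show i + k + 1 + (m - 1) = i + k + m by omega,
        show i + 1 + (m - 1) = i + m by omega] at this
    by_cases h0 : w (i + k) = w i
    · have hw : wordAt w (i + k) n = wordAt w i n := by
        rw [wordAt_eq_iff]
        intro m hm
        rcases Nat.eq_zero_or_pos m with rfl | hm0
        · simpa using h0
        · exact hshift m hm0 hm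
      obtain ⟨y, hy, hne⟩ := hb
      exact hnb (branchesAt_of_ne (hy.trans hw) hw hne)
    · refine avoid k hk ((wordAt_eq_iff _ _ _ _).2 fun m hm => ?_)
      rcases Nat.eq_zero_or_pos m with rfl | hm0
      · exact (Bool.eq_not_of_ne h0).trans (Bool.eq_not_of_ne hij.symm).symm
      · rw [hshift m hm0 hm, hcom m hm0 hm]
  have hfin : (factorsOfLength w n \ {wordAt w j n}).Finite :=
    (hst.finite_factorsOfLength n).sdiff
  have hcard : hfin.toFinset.card = n := by
    rw [← Set.ncard_eq_toFinset_card _ hfin,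
      Set.ncard_sdiff_singleton_of_mem (show wordAt w j n ∈ factorsOfLength w n from ⟨j, rfl⟩),
      hst.ncard_factorsOfLength]
    omega
  obtain ⟨x, hx, y, hy, hxy, he⟩ := Finset.exists_ne_map_eq_of_card_lt_of_maps_to
    (s := Finset.range (n + 1)) (t := hfin.toFinset) (f := fun k => wordAt w (i + k) n)
    (by rw [hcard, Finset.card_range]; omega) (by
      intro k hk
      have hk' : k ≤ n := by
        have := Finset.mem_range.1 (Finset.mem_coe.1 hk)
        omega
      simp only [Set.Finite.coe_toFinset]
      exact ⟨⟨_, rfl⟩, avoid k hk'⟩)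
  simp only [Finset.mem_range] at hx hy
  have close : ∀ x y, x < y → y < n + 1 → wordAt w (i + x) n = wordAt w (i + y) n → False := by
    intro x y hxy hy he
    refine hst.1 (ultPeriodicW_of_not_branchesAt (by omega) he fun z hz hzy => ?_)
    have := hdet (z - i) (by omega)
    rwa [show i + (z - i) = z by omega] at this
  rcases lt_or_gt_of_ne hxy with h | h
  · exact close x y h hy he
  · exact close y x h hx he.symm

/-- The number of occurrences of `true` among the first `n` letters of `w`. -/
def prefixCount (w : ℕ → Bool) (n : ℕ) : ℤ :=
  ∑ i ∈ Finset.range n, if w i then 1 else 0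

theorem prefixCount_succ (w : ℕ → Bool) (n : ℕ) :
    prefixCount w (n + 1) = prefixCount w n + if w n then 1 else 0 :=
  Finset.sum_range_succ _ _

/-- The number of occurrences of `true` in the factor of length `n` at position `i`. -/
def windowCount (w : ℕ → Bool) (i n : ℕ) : ℤ :=
  prefixCount w (i + n) - prefixCount w i

theorem count_true_wordAt (w : ℕ → Bool) (i n : ℕ) :
    ((wordAt w i n).count true : ℤ) = windowCount w i n := by
  induction n with
  | zero => simp [wordAt, windowCount]
  | succ n ih =>
    rw [wordAt_succ, List.count_append, Nat.cast_add, ih, windowCount, windowCount, ← add_assoc,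
      prefixCount_succ]
    cases w (i + n) <;> simp
    ring

theorem SturmianW.windowCount_le {w : ℕ → Bool} (hst : SturmianW w) (n i j : ℕ) :
    windowCount w i n ≤ windowCount w j n + 1 := by
  induction n using Nat.strong_induction_on generalizing i j with
  | _ n ih =>
  by_contra! hlt
  have ih' : ∀ m < n, ∀ i j, prefixCount w (i + m) - prefixCount w i ≤
      prefixCount w (j + m) - prefixCount w j + 1 := fun m hm i j => ih m hm i j
  unfold windowCount at hlt
  have hn : 2 ≤ n := by
    by_contra! h
    interval_cases n
    · simp at hlt
    · rw [prefixCount_succ, prefixCount_succ] at hlt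
      split_ifs at hlt <;> omega
  have hd : ∀ m, 0 < m → m < n →
      prefixCount w (i + m) - prefixCount w i = prefixCount w (j + m) - prefixCount w j + 1 := by
    intro m hm hmn
    have h1 := ih' m hmn i j
    have h2 := ih' (n - m) (by omega) (i + m) (j + m)
    rw [show i + m + (n - m) = i + n by omega, show j + m + (n - m) = j + n by omega] at h2
    omega
  have hi0 : w i = true ∧ w j = false := by
    have h := hd 1 one_pos (by omega)
    rw [prefixCount_succ, prefixCount_succ] at h
    cases h1 : w i <;> cases h2 : w j <;> simp [h1, h2] at h ⊢
  have hin : w (i + (n - 1)) = true ∧ w (j + (n - 1)) = false := by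
    have h := hd (n - 1) (by omega) (by omega)
    have h1 := prefixCount_succ w (i + (n - 1))
    have h2 := prefixCount_succ w (j + (n - 1))
    rw [show i + (n - 1) + 1 = i + n by omega] at h1
    rw [show j + (n - 1) + 1 = j + n by omega] at h2
    cases h3 : w (i + (n - 1)) <;> cases h4 : w (j + (n - 1)) <;> simp [h3, h4] at h1 h2 ⊢ <;>
      omega
  have hcom : ∀ m, 0 < m → m < n - 1 → w (i + m) = w (j + m) := by
    intro m hm hmn
    have h := hd m hm (by omega)
    have h' := hd (m + 1) (by omega) (by omega)
    rw [← add_assoc, ← add_assoc, prefixCount_succ, prefixCount_succ] at h'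
    cases h3 : w (i + m) <;> cases h4 : w (j + m) <;> simp [h3, h4] at h' ⊢ <;> omega
  have hpi : prefixCount w (i + 1) = prefixCount w i + 1 := by
    rw [prefixCount_succ, hi0.1]; simp
  have hpj : prefixCount w (j + 1) = prefixCount w j := by
    rw [prefixCount_succ, hi0.2]; simp
  have hpin : prefixCount w (i + n) = prefixCount w (i + (n - 1)) + 1 := by
    rw [show i + n = i + (n - 1) + 1 by omega, prefixCount_succ, hin.1]; simp
  have hpjn : prefixCount w (j + n) = prefixCount w (j + (n - 1)) := by
    rw [show j + n = j + (n - 1) + 1 by omega, prefixCount_succ, hin.2]; simp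
  have letters_eq : ∀ m, 0 < m → m < n - 1 →
      prefixCount w (i + m) - prefixCount w (i + 1) =
        prefixCount w (i + (n - 1)) - prefixCount w (i + (n - m)) →
      w (i + m) = w (i + (n - 1 - m)) := by
    intro m hm hmn h
    have e1 := prefixCount_succ w (i + m)
    have e2 := prefixCount_succ w (i + (n - 1 - m))
    have e3 := prefixCount_succ w (j + m)
    have e4 := prefixCount_succ w (j + (n - 1 - m))
    rw [show i + (n - 1 - m) + 1 = i + (n - m) by omega] at e2
    rw [show j + (n - 1 - m) + 1 = j + (n - m) by omega] at e4
    rw [← hcom m hm hmn] at e3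
    rw [← hcom (n - 1 - m) (by omega) (by omega)] at e4
    have d1 := hd m hm (by omega)
    have d2 := hd (n - m) (by omega) (by omega)
    have d3 := hd (n - 1) (by omega) (by omega)
    have b1 := ih' (m + 1) (by omega) i (j + (n - 1 - m))
    have b2 := ih' (m + 1) (by omega) (i + (n - 1 - m)) j
    rw [show i + (n - 1 - m) + (m + 1) = i + n by omega, ← add_assoc] at b2
    rw [show j + (n - 1 - m) + (m + 1) = j + n by omega, ← add_assoc] at b1
    cases h3 : w (i + m) <;> cases h4 : w (i + (n - 1 - m)) <;>
      simp [h3, h4] at e1 e2 e3 e4 ⊢ <;> omega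
  have hsum : ∀ m, m + 1 < n → prefixCount w (i + (m + 1)) - prefixCount w (i + 1) =
      prefixCount w (i + (n - 1)) - prefixCount w (i + (n - (m + 1))) := by
    intro m
    induction m with
    | zero => intro _; simp
    | succ m ihm =>
      intro hm
      have h := ihm (by omega)
      have hl := letters_eq (m + 1) (by omega) (by omega) h
      have e1 := prefixCount_succ w (i + (m + 1))
      have e2 := prefixCount_succ w (i + (n - 1 - (m + 1)))
      rw [show i + (n - 1 - (m + 1)) + 1 = i + (n - (m + 1)) by omega, ← hl] at e2
      rw [show i + (m + 1 + 1) = i + (m + 1) + 1 by omega,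
        show n - (m + 1 + 1) = n - 1 - (m + 1) by omega]
      omega
  have hpal : ∀ m, 0 < m → m < n - 1 → w (i + m) = w (i + (n - 1 - m)) := by
    intro m hm hmn
    refine letters_eq m hm hmn ?_
    have := hsum (m - 1) (by omega)
    rwa [show m - 1 + 1 = m by omega] at this
  have hne : w i ≠ w j := by simp [hi0]
  have hii : w (i + (n - 1)) = w i := hin.1.trans hi0.1.symm
  have hjj : w (j + (n - 1)) = w j := hin.2.trans hi0.2.symm
  have bi := hst.branchesAt_of_palindrome (by omega) hne hii hjj hcom hpal
  have bj := hst.branchesAt_of_palindrome (by omega) hne.symm hjj hii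
    (fun m hm hmn => (hcom m hm hmn).symm) (fun m hm hmn => by
      rw [← hcom m hm hmn, hpal m hm hmn, hcom (n - 1 - m) (by omega) (by omega)])
  have h := (wordAt_eq_iff _ _ _ _).1 (hst.wordAt_eq_of_branchesAt bi bj) 0 (by omega)
  exact hne (by simpa using h)

theorem AbEquiv.length_eq {u v : List Bool} (h : AbEquiv u v) : u.length = v.length := by
  rw [← List.count_not_add_count u true, ← List.count_not_add_count v true, h, h]

theorem abEquiv_iff_count_true {u v : List Bool} (hl : u.length = v.length) :
    AbEquiv u v ↔ u.count true = v.count true := by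
  refine ⟨fun h => h true, fun h a => ?_⟩
  have h1 := List.count_not_add_count u true
  have h2 := List.count_not_add_count v true
  cases a
  · simp only [Bool.not_true] at h1 h2
    omega
  · exact h

theorem mem_abOcc_iff (w : ℕ → Bool) (u : List Bool) (i : ℕ) :
    i ∈ abOcc w u ↔ windowCount w i u.length = u.count true := by
  rw [← count_true_wordAt, Nat.cast_inj]
  exact abEquiv_iff_count_true (wordAt_length _ _ _)

theorem windowCount_succ (w : ℕ → Bool) (i n : ℕ) :
    windowCount w (i + 1) n + (if w i then 1 else 0) =
      windowCount w i n + if w (i + n) then 1 else 0 := by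
  have h1 := prefixCount_succ w i
  have h2 := prefixCount_succ w (i + n)
  rw [windowCount, windowCount, show i + 1 + n = i + n + 1 by omega]
  omega

/-- Between two consecutive visits of the window count to `c`, at distance at least two, the word
read is `a v b` with `v` right special. -/
theorem branchesAt_of_excursion {w : ℕ → Bool} {n i l : ℕ} {c e : ℤ} (hl : 1 < l) (he : e ≠ c)
    (hi : windowCount w i n = c) (hil : windowCount w (i + l) n = c)
    (hmid : ∀ m, 0 < m → m < l → windowCount w (i + m) n = e) :
    w i = decide (e < c) ∧ w (i + (l - 1)) = decide (c < e) ∧ BranchesAt w (l - 2) (i + 1) := by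
  have first := windowCount_succ w i n
  have last := windowCount_succ w (i + (l - 1)) n
  rw [hmid 1 one_pos hl, hi] at first
  rw [show i + (l - 1) + 1 = i + l by omega, hil, hmid (l - 1) (by omega) (by omega)] at last
  refine ⟨?_, ?_, i + 1 + n, ?_, ?_⟩
  · cases h1 : w i <;> cases h2 : w (i + n) <;> simp [h1, h2] at first ⊢ <;> omega
  · cases h1 : w (i + (l - 1)) <;> cases h2 : w (i + (l - 1) + n) <;>
      simp [h1, h2] at last ⊢ <;> omega
  · rw [wordAt_eq_iff]
    intro m hm
    have h := windowCount_succ w (i + (m + 1)) n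
    rw [add_assoc, hmid (m + 1) (by omega) (by omega), hmid (m + 1 + 1) (by omega) (by omega)] at h
    rw [show i + 1 + n + m = i + (m + 1) + n by omega, show i + 1 + m = i + (m + 1) by omega]
    cases h1 : w (i + (m + 1)) <;> cases h2 : w (i + (m + 1) + n) <;> simp [h1, h2] at h ⊢
  · rw [show i + 1 + n + (l - 2) = i + (l - 1) + n by omega,
      show i + 1 + (l - 2) = i + (l - 1) by omega]
    intro h
    rw [h] at last
    omega

theorem SturmianW.semiAbReturns_eq_of_length {w : ℕ → Bool} (hst : SturmianW w)
    {u r₁ r₂ : List Bool} (h₁ : r₁ ∈ semiAbReturns w u) (h₂ : r₂ ∈ semiAbReturns w u)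
    (hlen : r₁.length = r₂.length) (hl : 1 < r₁.length) : r₁ = r₂ := by
  obtain ⟨i, j, hi, hj, hij, hmid, rfl⟩ := h₁
  obtain ⟨i', j', hi', hj', hij', hmid', rfl⟩ := h₂
  rw [wordAt_length, wordAt_length] at hlen
  rw [wordAt_length] at hl
  rw [← hlen]
  obtain ⟨l, rfl⟩ := Nat.exists_eq_add_of_lt hij
  obtain rfl : j' = i' + (l + 1) := by omega
  simp only [mem_abOcc_iff] at hi hj hi' hj' hmid hmid'
  rw [show i + l + 1 - i = l + 1 by omega] at hl ⊢
  set c : ℤ := ((u.count true : ℕ) : ℤ)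
  set e := windowCount w (i + 1) u.length with he
  have hec : e ≠ c := hmid _ (by omega) (by omega)
  have excursion : ∀ k, windowCount w k u.length ≠ c → windowCount w k u.length = e := by
    intro k hk
    have h1 := hst.windowCount_le u.length k (i + 1)
    have h2 := hst.windowCount_le u.length (i + 1) k
    have h3 := hst.windowCount_le u.length k i
    have h4 := hst.windowCount_le u.length i k
    have h5 := hst.windowCount_le u.length i (i + 1)
    have h6 := hst.windowCount_le u.length (i + 1) i
    omega
  obtain ⟨f, g, b⟩ := branchesAt_of_excursion hl hec hi hj
    fun m hm hml => excursion _ (hmid _ (by omega) (by omega))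
  obtain ⟨f', g', b'⟩ := branchesAt_of_excursion hl hec hi' hj'
    fun m hm hml => excursion _ (hmid' _ (by omega) (by omega))
  have hv := hst.wordAt_eq_of_branchesAt b b'
  rw [wordAt_eq_iff] at hv ⊢
  intro m hm
  rcases Nat.eq_zero_or_pos m with rfl | hm0
  · exact f.trans f'.symm
  rcases Nat.lt_or_ge m l with hml | hml
  · have := hv (m - 1) (by omega)
    rwa [show i + 1 + (m - 1) = i + m by omega, show i' + 1 + (m - 1) = i' + m by omega] at this
  · obtain rfl : m = l := by omega
    exact g.trans g'.symm

/-- In a Sturmian word, no factor of length greater than one admits two distinct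
abelian-equivalent semi-abelian returns; equivalently, any two semi-abelian returns of a
factor having the same length `l > 1` are equal. -/
theorem stmt16 (w : ℕ → Bool) (hst : SturmianW w) :
    (∀ u, IsFactorW w u → 1 < u.length →
      ∀ r₁ ∈ semiAbReturns w u, ∀ r₂ ∈ semiAbReturns w u, AbEquiv r₁ r₂ → r₁ = r₂) ∧
    (∀ u, IsFactorW w u → u ≠ [] →
      ∀ r₁ ∈ semiAbReturns w u, ∀ r₂ ∈ semiAbReturns w u,
        r₁.length = r₂.length → 1 < r₁.length → r₁ = r₂) := by
  refine ⟨fun u _ _ r₁ h₁ r₂ h₂ hab => ?_, fun u _ _ r₁ h₁ r₂ h₂ hlen hl =>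
    hst.semiAbReturns_eq_of_length h₁ h₂ hlen hl⟩
  rcases Nat.lt_or_ge 1 r₁.length with hl | hl
  · exact hst.semiAbReturns_eq_of_length h₁ h₂ hab.length_eq hl
  · have hperm : r₁.Perm r₂ := List.perm_iff_count.2 hab
    match r₁, hl with
    | [], _ => exact hperm.nil_eq
    | [a], _ => exact (List.perm_singleton.1 hperm.symm).symm
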